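/- Let Φ = {φ_j}_{j=1}^N be a nonlattice, strongly separated self-similar system on ℝ^m with attractor F and scaling vector r; set D := D_r, x_1 := sup{x > 0 : N_B(F,x) = 1}, and L(x) := N_B(F,x) − ∑_{j=1}^N N_B(F, r_j x), and define h(s) := (N−1)·x_1^{−s} + s·∫_{x_1}^∞ L(x)·x^{−s−1} dx for s ∈ ℂ (the integral converges for every s ∈ ℂ since L is bounded and vanishes for all sufficiently large x). Assume h(ω) ≠ 0 for every ω ∈ S_r. Then F is box-counting measurable: the limit lim_{x→∞} N_B(F,x)/x^D exists, lies in (0,∞), and equals h(D)/(D·∑_{j=1}^N r_j^D·log(1/r_j)). -/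

import Mathlib

open Filter Topology Metric MeasureTheory

/-- A scaling vector is *lattice* if its components are powers `ρ ^ (k j)` of a common
ratio `ρ ∈ (0,1)` with positive integer exponents whose gcd is `1`. -/
def IsLatticeVec {N : ℕ} (r : Fin N → ℝ) : Prop :=
  ∃ (ρ : ℝ) (k : Fin N → ℕ), ρ ∈ Set.Ioo (0 : ℝ) 1 ∧ (∀ j, 0 < k j) ∧
    Finset.univ.gcd k = 1 ∧ ∀ j, r j = ρ ^ (k j)

/-- The box-counting function `N_B(A,x)`: the maximal number of pairwise disjoint closed
balls of radius `x⁻¹` whose centers lie in `A`. -/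
noncomputable def boxCount {m : ℕ} (A : Set (EuclideanSpace ℝ (Fin m))) (x : ℝ) : ℕ :=
  sSup {n : ℕ | ∃ c : Fin n → EuclideanSpace ℝ (Fin m), (∀ i, c i ∈ A) ∧
    Pairwise fun i j => Disjoint (closedBall (c i) x⁻¹) (closedBall (c j) x⁻¹)}

/-- `φ` is a contracting similarity with scaling ratio `ρ`. -/
def IsSimilarity {X : Type*} [MetricSpace X] (φ : X → X) (ρ : ℝ) : Prop :=
  ∀ x y, dist (φ x) (φ y) = ρ * dist x y

/-- The set of complex solutions of the Moran equation `∑ r_j^s = 1`. -/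
def MoranSet {N : ℕ} (r : Fin N → ℝ) : Set ℂ :=
  {s : ℂ | ∑ j, ((r j : ℂ)) ^ s = 1}

/-- For reals generating a dense subgroup, the additive submonoid they generate contains
arbitrarily long arithmetic progressions of arbitrarily small step. -/
lemma exists_progression_mem_closure {s : Set ℝ}
    (hs : Dense (AddSubgroup.closure s : Set ℝ)) {ε : ℝ} (hε : 0 < ε) (W : ℝ) :
    ∃ (q h : ℝ) (K : ℕ), 0 < h ∧ h < ε ∧ W ≤ K * h ∧
      ∀ i : ℕ, i ≤ K → q + i * h ∈ AddSubmonoid.closure s := by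
  obtain ⟨h, hmem, h0, hlt⟩ : ∃ h ∈ (AddSubgroup.closure s : Set ℝ), 0 < h ∧ h < ε := by
    obtain ⟨h, h1, h2⟩ := hs.exists_between hε
    exact ⟨h, h1, h2⟩
  have key : ∀ x ∈ AddSubgroup.closure s, ∃ u ∈ AddSubmonoid.closure s,
      ∃ v ∈ AddSubmonoid.closure s, x = u - v := by
    intro x hx
    induction hx using AddSubgroup.closure_induction with
    | mem x hx => exact ⟨x, AddSubmonoid.subset_closure hx, 0, zero_mem _, by simp⟩
    | zero => exact ⟨0, zero_mem _, 0, zero_mem _, by simp⟩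
    | add x y _ _ hx hy =>
      obtain ⟨u, hu, v, hv, rfl⟩ := hx
      obtain ⟨u', hu', v', hv', rfl⟩ := hy
      exact ⟨u + u', add_mem hu hu', v + v', add_mem hv hv', by ring⟩
    | neg x _ hx =>
      obtain ⟨u, hu, v, hv, rfl⟩ := hx
      exact ⟨v, hv, u, hu, by ring⟩
  obtain ⟨u, hu, v, hv, huv⟩ := key h hmem
  obtain ⟨K, hK⟩ := exists_nat_ge (W / h)
  refine ⟨K * v, h, K, h0, hlt, (div_le_iff₀ h0).1 hK, fun i hi => ?_⟩
  have h1 := add_mem (nsmul_mem hv (K - i)) (nsmul_mem hu i)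
  convert h1 using 1
  rw [nsmul_eq_mul, nsmul_eq_mul, Nat.cast_sub hi, huv]
  ring

/-- If the ratios are not lattice, their logarithms generate a dense subgroup of `ℝ`. -/
lemma dense_closure_range_log_of_not_isLatticeVec {N : ℕ} (hN : 0 < N) {r : Fin N → ℝ}
    (hr : ∀ j, r j ∈ Set.Ioo (0 : ℝ) 1) (hnl : ¬ IsLatticeVec r) :
    Dense (AddSubgroup.closure (Set.range fun j => -Real.log (r j)) : Set ℝ) := by
  rcases AddSubgroup.dense_or_cyclic
    (AddSubgroup.closure (Set.range fun j => -Real.log (r j))) with h | ⟨b, hb⟩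
  · exact h
  refine absurd ?_ hnl
  have hpos : ∀ j, 0 < -Real.log (r j) := fun j =>
    neg_pos.2 (Real.log_neg (hr j).1 (hr j).2)
  have hint : ∀ j, ∃ n : ℤ, -Real.log (r j) = n * b := fun j => by
    have : -Real.log (r j) ∈ AddSubgroup.closure {b} :=
      hb ▸ AddSubgroup.subset_closure ⟨j, rfl⟩
    obtain ⟨n, hn⟩ := AddSubgroup.mem_closure_singleton.1 this
    exact ⟨n, by rw [← hn, zsmul_eq_mul]⟩
  choose n hn using hint
  have hnat : ∀ j, -Real.log (r j) = (n j).natAbs * |b| := fun j => by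
    rw [← abs_of_pos (hpos j), hn j, abs_mul, Nat.cast_natAbs, Int.cast_abs]
  have j₀ : Fin N := ⟨0, hN⟩
  obtain ⟨k, hk, hk1⟩ := Finset.extract_gcd (s := Finset.univ) (fun j => (n j).natAbs)
    ⟨j₀, Finset.mem_univ _⟩
  set d := Finset.univ.gcd fun j => (n j).natAbs with hd
  have hlog : ∀ j, -Real.log (r j) = k j * (d * |b|) := fun j => by
    have h1 : (n j).natAbs = d * k j := hk j (Finset.mem_univ j)
    rw [hnat j, h1]
    push_cast
    ring
  have hdb : 0 < d * |b| := by
    have h1 := hpos j₀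
    rw [hlog j₀] at h1
    exact pos_of_mul_pos_right h1 (Nat.cast_nonneg _)
  refine ⟨Real.exp (-(d * |b|)), k, ⟨Real.exp_pos _, by simpa using hdb⟩, fun j => ?_, hk1,
    fun j => ?_⟩
  · rcases Nat.eq_zero_or_pos (k j) with h0 | h0
    · have h1 := hpos j
      rw [hlog j, h0] at h1
      simp at h1
    · exact h0
  · rw [← Real.exp_nat_mul, mul_neg, ← hlog j, neg_neg, Real.exp_log (hr j).1]

section Renewal

variable {ι : Type*} [Fintype ι] {p a : ι → ℝ} {g : ℝ → ℝ} {T D M I : ℝ}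

/-- If `g` eventually satisfies a convex averaging equation and is asymptotically at most `M`,
then near-maximality at `t` propagates to `t - s` for `s` a sum of delays. -/
lemma eventually_propagate_of_averaging (hp : ∀ j, 0 < p j) (hp1 : ∑ j, p j = 1)
    (heq : ∀ t, T ≤ t → g t = ∑ j, p j * g (t - a j))
    (hM : ∀ η, 0 < η → ∀ᶠ t in atTop, g t ≤ M + η) {s : ℝ}
    (hs : s ∈ AddSubmonoid.closure (Set.range a)) :
    ∀ δ, 0 < δ → ∀ᶠ η in 𝓝[>] (0 : ℝ), ∀ᶠ t in atTop, M - η ≤ g t → M - δ ≤ g (t - s) := by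
  classical
  induction hs using AddSubmonoid.closure_induction with
  | mem s hs =>
    obtain ⟨j, rfl⟩ := hs
    intro δ hδ
    have hpj := hp j
    filter_upwards [Ioo_mem_nhdsGT (show (0 : ℝ) < δ * p j / 2 by positivity)] with η hη
    have h1 : ∀ᶠ t in atTop, ∀ i, g (t - a i) ≤ M + η := by
      rw [eventually_all]
      intro i
      exact (tendsto_atTop_add_const_right atTop (-a i) tendsto_id).eventually (hM η hη.1)
    filter_upwards [h1, eventually_ge_atTop T] with t ht hT hMt
    have h2 := heq t hT
    rw [← Finset.add_sum_erase _ _ (Finset.mem_univ j)] at h2 hp1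
    have h3 : ∑ i ∈ Finset.univ.erase j, p i * g (t - a i) ≤
        (∑ i ∈ Finset.univ.erase j, p i) * (M + η) := by
      rw [Finset.sum_mul]
      exact Finset.sum_le_sum fun i _ => mul_le_mul_of_nonneg_left (ht i) (hp i).le
    have h4 : ∑ i ∈ Finset.univ.erase j, p i = 1 - p j := by linarith
    rw [h4] at h3
    have h5 : p j * (M - δ) ≤ p j * g (t - a j) := by
      nlinarith [mul_pos hpj hη.1, hη.2]
    exact le_of_mul_le_mul_left h5 hpj
  | zero =>
    intro δ hδ
    filter_upwards [Ioo_mem_nhdsGT hδ] with η hη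
    refine Eventually.of_forall fun t ht => ?_
    rw [sub_zero]
    linarith [hη.2]
  | add s s' _ _ hs hs' =>
    intro δ hδ
    obtain ⟨η', h1, h2⟩ := ((hs' δ hδ).and self_mem_nhdsWithin).exists
    filter_upwards [hs η' h2] with η hη
    filter_upwards [hη, (tendsto_atTop_add_const_right atTop (-s) tendsto_id).eventually h1]
      with t ht ht' hMt
    rw [← sub_sub]
    exact ht' (ht hMt)

lemma frequently_forall_of_averaging (hp : ∀ j, 0 < p j) (hp1 : ∑ j, p j = 1)
    (heq : ∀ t, T ≤ t → g t = ∑ j, p j * g (t - a j))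
    (hM : ∀ η, 0 < η → ∀ᶠ t in atTop, g t ≤ M + η)
    (hM' : ∀ η, 0 < η → ∃ᶠ t in atTop, M - η ≤ g t) {q h : ℝ} {K : ℕ}
    (hs : ∀ i : ℕ, i ≤ K → q + i * h ∈ AddSubmonoid.closure (Set.range a))
    {δ : ℝ} (hδ : 0 < δ) :
    ∃ᶠ t in atTop, ∀ i : ℕ, i ≤ K → M - δ ≤ g (t - (q + i * h)) := by
  have h1 : ∀ᶠ η in 𝓝[>] (0 : ℝ), ∀ i ∈ Finset.range (K + 1), ∀ᶠ t in atTop,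
      M - η ≤ g t → M - δ ≤ g (t - (q + i * h)) := by
    rw [eventually_all_finset]
    intro i hi
    exact eventually_propagate_of_averaging hp hp1 heq hM
      (hs i (Nat.lt_succ_iff.1 (Finset.mem_range.1 hi))) δ hδ
  obtain ⟨η, h2, h3⟩ := (h1.and self_mem_nhdsWithin).exists
  rw [← eventually_all_finset] at h2
  refine ((hM' η h3).and_eventually h2).mono fun t ht i hi => ?_
  exact ht.2 i (Finset.mem_range.2 (Nat.lt_succ_iff.2 hi)) ht.1

lemma mul_le_sum_integral (hp : ∀ j, 0 < p j) (ha : ∀ j, 0 < a j) {W : ℝ}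
    (haW : ∀ j, a j ≤ W) (hint : ∀ x y, IntervalIntegrable g volume x y) {t C : ℝ}
    (hC : ∀ u ∈ Set.Icc (t - W) t, C ≤ g u) :
    (∑ j, p j * a j) * C ≤ ∑ j, p j * ∫ u in (t - a j)..t, g u := by
  rw [Finset.sum_mul]
  refine Finset.sum_le_sum fun j _ => ?_
  rw [mul_assoc]
  refine mul_le_mul_of_nonneg_left ?_ (hp j).le
  have h1 := intervalIntegral.integral_mono_on (μ := volume) (a := t - a j) (b := t)
    (f := fun _ => C) (g := g) (by linarith [ha j]) (by simp) (hint _ _)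
    fun u hu => hC u ⟨by linarith [haW j, hu.1], hu.2⟩
  simpa using h1

lemma sum_integral_le_mul (hp : ∀ j, 0 < p j) (ha : ∀ j, 0 < a j) {W : ℝ}
    (haW : ∀ j, a j ≤ W) (hint : ∀ x y, IntervalIntegrable g volume x y) {t C : ℝ}
    (hC : ∀ u ∈ Set.Icc (t - W) t, g u ≤ C) :
    ∑ j, p j * ∫ u in (t - a j)..t, g u ≤ (∑ j, p j * a j) * C := by
  have h1 := mul_le_sum_integral (g := fun u => -g u) (C := -C) hp ha haW
    (fun x y => (hint x y).neg) (t := t) fun u hu => neg_le_neg (hC u hu)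
  simp only [intervalIntegral.integral_neg, mul_neg, Finset.sum_neg_distrib] at h1
  linarith

/-- A renewal theorem for finitely many delays generating a dense subgroup, for nonnegative
functions `g` that decay at most exponentially. -/
theorem tendsto_of_averaging [Nonempty ι] (hp : ∀ j, 0 < p j) (hp1 : ∑ j, p j = 1)
    (ha : ∀ j, 0 < a j) (hdense : Dense (AddSubgroup.closure (Set.range a) : Set ℝ))
    (hD : 0 < D) (hg : ∀ t, 0 ≤ g t)
    (hmono : ∀ t v, 0 ≤ v → Real.exp (-D * v) * g t ≤ g (t + v))
    (hint : ∀ x y, IntervalIntegrable g volume x y)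
    (heq : ∀ t, T ≤ t → g t = ∑ j, p j * g (t - a j))
    (hI : ∀ t, T ≤ t → ∑ j, p j * ∫ u in (t - a j)..t, g u = I) :
    Tendsto g atTop (𝓝 (I / ∑ j, p j * a j)) := by
  set μ := ∑ j, p j * a j with hμ
  have hμ0 : 0 < μ := Finset.sum_pos (fun j _ => mul_pos (hp j) (ha j)) Finset.univ_nonempty
  obtain ⟨W, hW⟩ : ∃ W, ∀ j, a j ≤ W :=
    ⟨∑ j, a j, fun j => Finset.single_le_sum (fun i _ => (ha i).le) (Finset.mem_univ j)⟩
  have hmono' : ∀ t u ε, t ≤ u → u ≤ t + ε → Real.exp (-D * ε) * g t ≤ g u := by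
    intro t u ε h1 h2
    have h3 := hmono t (u - t) (by linarith)
    rw [add_sub_cancel] at h3
    refine le_trans (mul_le_mul_of_nonneg_right (Real.exp_le_exp.2 ?_) (hg t)) h3
    nlinarith
  have hbdd : ∀ᶠ t in atTop, g t ≤ I / (μ * Real.exp (-D * W)) := by
    filter_upwards [eventually_ge_atTop (T - W)] with t ht
    rw [le_div_iff₀ (by positivity)]
    have h1 := mul_le_sum_integral (t := t + W) (C := Real.exp (-D * W) * g t) hp ha hW hint
      fun u hu => hmono' t u W (by linarith [hu.1]) hu.2
    rw [hI _ (by linarith)] at h1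
    linarith
  have hb1 : IsBoundedUnder (· ≤ ·) atTop g := isBoundedUnder_of_eventually_le hbdd
  have hb2 : IsBoundedUnder (· ≥ ·) atTop g :=
    isBoundedUnder_of_eventually_ge (Eventually.of_forall hg)
  have hexp : ∀ (σ κ c : ℝ), Tendsto (fun ε : ℝ => μ * (Real.exp (σ * ε) * (c + κ * ε)))
      (𝓝[>] 0) (𝓝 (μ * c)) := by
    intro σ κ c
    have : Continuous fun ε : ℝ => μ * (Real.exp (σ * ε) * (c + κ * ε)) := by fun_prop
    have h1 := (this.tendsto 0).mono_left (nhdsWithin_le_nhds (s := Set.Ioi (0 : ℝ)))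
    simpa using h1
  refine tendsto_of_le_liminf_of_limsup_le ?_ ?_ hb1 hb2
  · rw [div_le_iff₀ hμ0, mul_comm]
    set m := liminf g atTop with hm
    refine ge_of_tendsto (hexp D 1 m) ?_
    filter_upwards [self_mem_nhdsWithin] with ε hε
    rw [Set.mem_Ioi] at hε
    obtain ⟨q, h, K, h0, hlt, hK, hmem⟩ := exists_progression_mem_closure hdense hε W
    have hfr := frequently_forall_of_averaging (g := fun t => -g t) (M := -m) (T := T) hp hp1
      (fun t ht => by rw [heq t ht]; simp)
      (fun η hη => by
        filter_upwards [eventually_lt_of_lt_liminf (show m - η < liminf g atTop by linarith) hb2]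
          with t ht
        linarith)
      (fun η hη => by
        refine (frequently_lt_of_liminf_lt hb1.isCoboundedUnder_ge
          (show liminf g atTop < m + η by linarith)).mono fun t ht => ?_
        linarith) hmem hε
    obtain ⟨t, ht, htT⟩ := (hfr.and_eventually (eventually_ge_atTop (T + q))).exists
    rw [← hI (t - q) (by linarith)]
    refine sum_integral_le_mul hp ha hW hint fun u hu => ?_
    have hv : 0 ≤ (t - q - u) / h := div_nonneg (by linarith [hu.2]) h0.le
    have h1 := Nat.floor_le hv
    have h2 := Nat.lt_floor_add_one ((t - q - u) / h)
    rw [le_div_iff₀ h0] at h1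
    rw [div_lt_iff₀ h0] at h2
    set i := ⌊(t - q - u) / h⌋₊ with hi
    have hiK : i ≤ K := by
      have : (i : ℝ) ≤ K := le_of_mul_le_mul_right (by linarith [hu.1]) h0
      exact_mod_cast this
    have h3 := ht i hiK
    have h4 := hmono' u (t - (q + i * h)) ε (by linarith) (by linarith)
    have h5 : Real.exp (D * ε) * Real.exp (-D * ε) = 1 := by
      rw [← Real.exp_add]; simp
    calc g u = Real.exp (D * ε) * (Real.exp (-D * ε) * g u) := by rw [← mul_assoc, h5, one_mul]
      _ ≤ Real.exp (D * ε) * (m + 1 * ε) :=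
        mul_le_mul_of_nonneg_left (by linarith) (Real.exp_pos _).le
  · rw [le_div_iff₀ hμ0, mul_comm]
    set M := limsup g atTop with hM
    refine le_of_tendsto (hexp (-D) (-1) M) ?_
    filter_upwards [self_mem_nhdsWithin] with ε hε
    rw [Set.mem_Ioi] at hε
    obtain ⟨q, h, K, h0, hlt, hK, hmem⟩ := exists_progression_mem_closure hdense hε W
    have hfr := frequently_forall_of_averaging (g := g) (M := M) (T := T) hp hp1 heq
      (fun η hη => by
        filter_upwards [eventually_lt_of_limsup_lt (show limsup g atTop < M + η by linarith) hb1]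
          with t ht
        linarith)
      (fun η hη => by
        refine (frequently_lt_of_lt_limsup hb2.isCoboundedUnder_le
          (show M - η < limsup g atTop by linarith)).mono fun t ht => ?_
        linarith) hmem hε
    obtain ⟨t, ht, htT⟩ := (hfr.and_eventually (eventually_ge_atTop (T + q))).exists
    rw [← hI (t - q) (by linarith)]
    refine mul_le_sum_integral hp ha hW hint fun u hu => ?_
    have hv : 0 ≤ (t - q - u) / h := div_nonneg (by linarith [hu.2]) h0.le
    have h1 := Nat.le_ceil ((t - q - u) / h)
    have h2 := Nat.ceil_lt_add_one hv
    have hiK : ⌈(t - q - u) / h⌉₊ ≤ K :=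
      Nat.ceil_le.2 ((div_le_iff₀ h0).2 (by linarith [hu.1]))
    rw [div_le_iff₀ h0] at h1
    rw [← sub_lt_iff_lt_add, lt_div_iff₀ h0] at h2
    set i := ⌈(t - q - u) / h⌉₊ with hi
    have h3 := ht i hiK
    have h4 := hmono' (t - (q + i * h)) u ε (by linarith) (by linarith)
    refine le_trans (mul_le_mul_of_nonneg_left ?_ (Real.exp_pos _).le) h4
    linarith

/-- The functional `∑ p j ∫_{t - a j}^t g` changes by the integral of the defect of the
averaging equation. -/
lemma sum_integral_sub_sum_integral (hp1 : ∑ j, p j = 1)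
    (hint : ∀ x y, IntervalIntegrable g volume x y) (t t' : ℝ) :
    ∑ j, p j * (∫ u in (t' - a j)..t', g u) - ∑ j, p j * (∫ u in (t - a j)..t, g u) =
      ∫ u in t..t', (g u - ∑ j, p j * g (u - a j)) := by
  have hint' : ∀ j, IntervalIntegrable (fun u => p j * g (u - a j)) volume t t' := fun j => by
    have := (hint (t - a j) (t' - a j)).comp_sub_right (a j)
    simpa using this.const_mul (p j)
  have hsum : IntervalIntegrable (fun u => ∑ j, p j * g (u - a j)) volume t t' := by
    have h1 := IntervalIntegrable.sum Finset.univ fun j _ => hint' j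
    rwa [Finset.sum_fn] at h1
  rw [intervalIntegral.integral_sub (hint _ _) hsum,
    intervalIntegral.integral_finsetSum fun j _ => hint' j, ← Finset.sum_sub_distrib]
  have h1 : ∫ u in t..t', g u = ∑ j, p j * ∫ u in t..t', g u := by
    rw [← Finset.sum_mul, hp1, one_mul]
  rw [h1, ← Finset.sum_sub_distrib]
  refine Finset.sum_congr rfl fun j _ => ?_
  rw [intervalIntegral.integral_const_mul, intervalIntegral.integral_comp_sub_right,
    ← mul_sub, ← mul_sub]
  congr 1
  have e1 := intervalIntegral.integral_add_adjacent_intervals (hint (t - a j) t) (hint t t')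
  have e2 := intervalIntegral.integral_add_adjacent_intervals (hint (t - a j) (t' - a j))
    (hint (t' - a j) t')
  linarith

end Renewal

section BoxCount

variable {m : ℕ} {A F : Set (EuclideanSpace ℝ (Fin m))} {x y : ℝ}

lemma disjoint_closedBall_inv_iff (hx : 0 < x) (p q : EuclideanSpace ℝ (Fin m)) :
    Disjoint (closedBall p x⁻¹) (closedBall q x⁻¹) ↔ 2 < x * dist p q := by
  rw [disjoint_closedBall_closedBall_iff (inv_pos.2 hx).le (inv_pos.2 hx).le, ← two_mul,
    ← div_eq_mul_inv, div_lt_iff₀ hx, mul_comm x]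

lemma bddAbove_boxCount (hA : IsCompact A) (hx : 0 < x) :
    BddAbove {n : ℕ | ∃ c : Fin n → EuclideanSpace ℝ (Fin m), (∀ i, c i ∈ A) ∧
      Pairwise fun i j => Disjoint (closedBall (c i) x⁻¹) (closedBall (c j) x⁻¹)} := by
  obtain ⟨t, ht, hAt⟩ := Metric.totallyBounded_iff.1 hA.totallyBounded x⁻¹ (inv_pos.2 hx)
  refine ⟨ht.toFinset.card, ?_⟩
  rintro n ⟨c, hcA, hc⟩
  have h1 : ∀ i, ∃ y ∈ t, c i ∈ ball y x⁻¹ := fun i => by simpa using hAt (hcA i)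
  choose f hft hf using h1
  have hinj : Function.Injective f := by
    intro i j hij
    by_contra hne
    exact Set.disjoint_left.1 (hc hne) (ball_subset_closedBall (mem_ball_comm.1 (hf i)))
      (hij ▸ ball_subset_closedBall (mem_ball_comm.1 (hf j)))
  simpa using Finset.card_le_card_of_injOn (s := Finset.univ) f
    (fun i _ => by simpa using hft i) hinj.injOn

lemma exists_separated_boxCount (hA : IsCompact A) (hx : 0 < x) :
    ∃ c : Fin (boxCount A x) → EuclideanSpace ℝ (Fin m), (∀ i, c i ∈ A) ∧
      Pairwise fun i j => 2 < x * dist (c i) (c j) := by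
  simp only [← disjoint_closedBall_inv_iff hx]
  exact Nat.sSup_mem (s := {n : ℕ | ∃ c : Fin n → EuclideanSpace ℝ (Fin m), (∀ i, c i ∈ A) ∧
      Pairwise fun i j => Disjoint (closedBall (c i) x⁻¹) (closedBall (c j) x⁻¹)})
    ⟨0, Fin.elim0, fun i => i.elim0, fun i => i.elim0⟩ (bddAbove_boxCount hA hx)

lemma card_le_boxCount {ι : Type*} [Fintype ι] (hA : IsCompact A) (hx : 0 < x)
    (c : ι → EuclideanSpace ℝ (Fin m)) (hcA : ∀ i, c i ∈ A)
    (hc : Pairwise fun i j => 2 < x * dist (c i) (c j)) : Fintype.card ι ≤ boxCount A x := by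
  refine le_csSup (bddAbove_boxCount hA hx)
    ⟨c ∘ (Fintype.equivFin ι).symm, fun i => hcA _, fun i j hij => ?_⟩
  exact (disjoint_closedBall_inv_iff hx _ _).2 <| hc ((Fintype.equivFin ι).symm.injective.ne hij)

lemma boxCount_mono (hA : IsCompact A) (hx : 0 < x) (hxy : x ≤ y) :
    boxCount A x ≤ boxCount A y := by
  obtain ⟨c, hcA, hc⟩ := exists_separated_boxCount hA hx
  simpa using card_le_boxCount hA (hx.trans_le hxy) c hcA fun i j hij =>
    (hc hij).trans_le (mul_le_mul_of_nonneg_right hxy dist_nonneg)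

lemma one_le_boxCount (hA : IsCompact A) (hne : A.Nonempty) (hx : 0 < x) :
    1 ≤ boxCount A x := by
  obtain ⟨p, hp⟩ := hne
  simpa using card_le_boxCount (ι := Unit) hA hx (fun _ => p) (fun _ => hp)
    (Subsingleton.pairwise)

lemma sSup_boxCount_eq_one_pos (hA : IsCompact A) (hnt : A.Nontrivial) :
    0 < sSup {x : ℝ | 0 < x ∧ boxCount A x = 1} ∧
      ∀ x, 0 < x → x < sSup {x : ℝ | 0 < x ∧ boxCount A x = 1} → boxCount A x = 1 := by
  have hbdd : BddAbove {x : ℝ | 0 < x ∧ boxCount A x = 1} := by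
    obtain ⟨p, hp, q, hq, hpq⟩ := hnt
    have hd := dist_pos.2 hpq
    refine ⟨2 / dist p q, fun x hx => ?_⟩
    by_contra! hlt
    rw [div_lt_iff₀ hd] at hlt
    have h1 := card_le_boxCount hA hx.1 ![p, q]
      (by intro i; fin_cases i <;> simp [hp, hq])
      (by
        intro i j hij
        fin_cases i <;> fin_cases j <;> simp_all [dist_comm])
    rw [hx.2] at h1
    simp at h1
  have hmem : (diam A + 1)⁻¹ ∈ {x : ℝ | 0 < x ∧ boxCount A x = 1} := by
    have hd : 0 < diam A + 1 := by linarith [diam_nonneg (s := A)]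
    refine ⟨inv_pos.2 hd, le_antisymm ?_ (one_le_boxCount hA hnt.nonempty (inv_pos.2 hd))⟩
    obtain ⟨c, hcA, hc⟩ := exists_separated_boxCount hA (inv_pos.2 hd)
    by_contra! hlt
    have h1 := hc (show (⟨0, by omega⟩ : Fin (boxCount A (diam A + 1)⁻¹)) ≠ ⟨1, hlt⟩ by simp)
    have h2 := dist_le_diam_of_mem hA.isBounded (hcA ⟨0, by omega⟩) (hcA ⟨1, hlt⟩)
    dsimp only at h1
    rw [inv_mul_eq_div, lt_div_iff₀ hd] at h1
    linarith [diam_nonneg (s := A)]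
  refine ⟨hmem.1.trans_le (le_csSup hbdd hmem), fun x hx hlt => ?_⟩
  obtain ⟨y, hy, hxy⟩ := exists_lt_of_lt_csSup ⟨_, hmem⟩ hlt
  exact le_antisymm (hy.2 ▸ boxCount_mono hA hx hxy.le) (one_le_boxCount hA hnt.nonempty hx)

variable {N : ℕ} {φ : Fin N → EuclideanSpace ℝ (Fin m) → EuclideanSpace ℝ (Fin m)}
  {r : Fin N → ℝ}

lemma boxCount_le_sum (hr : ∀ j, 0 < r j) (hsim : ∀ j, IsSimilarity (φ j) (r j))
    (hF : IsCompact F) (hFinv : F = ⋃ j, φ j '' F) (hx : 0 < x) :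
    boxCount F x ≤ ∑ j, boxCount F (r j * x) := by
  classical
  obtain ⟨c, hcF, hc⟩ := exists_separated_boxCount hF hx
  have h1 : ∀ i, ∃ j, ∃ b ∈ F, φ j b = c i := fun i => by
    have h2 := hcF i
    rw [hFinv] at h2
    simpa using h2
  choose f b hbF hb using h1
  have h3 := Finset.card_eq_sum_card_fiberwise (s := Finset.univ) (t := Finset.univ) (f := f)
    (fun _ _ => Finset.mem_univ _)
  rw [Finset.card_univ, Fintype.card_fin] at h3
  rw [h3]
  refine Finset.sum_le_sum fun j _ => ?_
  rw [← Fintype.card_subtype]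
  refine card_le_boxCount hF (mul_pos (hr j) hx) (fun i => b i.1) (fun i => hbF i.1)
    fun i i' hii => ?_
  have h4 := hc (Subtype.coe_injective.ne hii)
  dsimp only at h4
  rw [← hb, ← hb, i.2, i'.2, hsim j] at h4
  linarith

lemma eventually_sum_le_boxCount (hr : ∀ j, 0 < r j) (hsim : ∀ j, IsSimilarity (φ j) (r j))
    (hF : IsCompact F) (hFinv : F = ⋃ j, φ j '' F)
    (hsep : Pairwise fun i j => Disjoint (φ i '' F) (φ j '' F)) :
    ∀ᶠ x in atTop, ∑ j, boxCount F (r j * x) ≤ boxCount F x := by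
  have hcont : ∀ j, Continuous (φ j) := fun j =>
    (LipschitzWith.of_dist_le_mul (K := ⟨r j, (hr j).le⟩) fun p q => (hsim j p q).le).continuous
  have hev : ∀ᶠ x : ℝ in atTop, ∀ i j, i ≠ j → ∀ p ∈ φ i '' F, ∀ q ∈ φ j '' F,
      2 < x * dist p q := by
    simp only [eventually_all]
    intro i j hij
    obtain ⟨ε, hε, h1⟩ := Metric.exists_pos_forall_lt_edist (hF.image (hcont i))
      (hF.image (hcont j)).isClosed (hsep hij)
    filter_upwards [eventually_gt_atTop (2 / (ε : ℝ))] with x hx p hp q hq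
    have hε' : (0 : ℝ) < ε := hε
    have h2 := h1 p hp q hq
    rw [edist_nndist, ENNReal.coe_lt_coe, ← NNReal.coe_lt_coe, coe_nndist] at h2
    rw [div_lt_iff₀ hε'] at hx
    have hx0 : 0 < x := by
      by_contra! h0
      nlinarith
    nlinarith
  filter_upwards [hev, eventually_gt_atTop 0] with x hx hx0
  have h1 := fun j => exists_separated_boxCount hF (mul_pos (hr j) hx0)
  choose c hcF hc using h1
  have h2 := card_le_boxCount (ι := Σ j, Fin (boxCount F (r j * x))) hF hx0
    (fun i => φ i.1 (c i.1 i.2))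
    (fun i => hFinv.symm.subset (Set.mem_iUnion.2 ⟨i.1, c i.1 i.2, hcF _ _, rfl⟩))
    (by
      rintro ⟨i, k⟩ ⟨j, l⟩ hne
      by_cases hij : i = j
      · subst hij
        have h3 := hc i (show k ≠ l by rintro rfl; exact hne rfl)
        dsimp only at h3 ⊢
        rw [hsim i]
        linarith
      · exact hx i j hij _ ⟨_, hcF _ _, rfl⟩ _ ⟨_, hcF _ _, rfl⟩)
  simpa using h2

lemma nontrivial_of_separated (hN : 2 ≤ N) (hF : F.Nonempty) (hFinv : F = ⋃ j, φ j '' F)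
    (hsep : Pairwise fun i j => Disjoint (φ i '' F) (φ j '' F)) : F.Nontrivial := by
  obtain ⟨p, hp⟩ := hF
  have hmem : ∀ j, φ j p ∈ F := fun j => by
    rw [hFinv]
    exact Set.mem_iUnion.2 ⟨j, p, hp, rfl⟩
  refine ⟨φ ⟨0, by omega⟩ p, hmem _, φ ⟨1, by omega⟩ p, hmem _, fun h => ?_⟩
  exact Set.disjoint_left.1 (hsep (show (⟨0, by omega⟩ : Fin N) ≠ ⟨1, by omega⟩ by simp))
    ⟨p, hp, rfl⟩ ⟨p, hp, h.symm⟩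

end BoxCount

lemma pos_of_sum_rpow_eq_one {N : ℕ} (hN : 2 ≤ N) {r : Fin N → ℝ}
    (hr : ∀ j, r j ∈ Set.Ioo (0 : ℝ) 1) {D : ℝ} (hD : ∑ j, r j ^ D = 1) : 0 < D := by
  by_contra! hD0
  have h1 : ∑ _j : Fin N, (1 : ℝ) ≤ ∑ j, r j ^ D := Finset.sum_le_sum fun j _ =>
    Real.one_le_rpow_of_pos_of_le_one_of_nonpos (hr j).1 (hr j).2.le hD0
  have h2 : (2 : ℝ) ≤ N := by exact_mod_cast hN
  simp only [Finset.sum_const, Finset.card_univ, Fintype.card_fin, nsmul_eq_mul, mul_one] at h1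
  linarith

lemma integral_exp_mul {D : ℝ} (hD : D ≠ 0) (x y : ℝ) :
    ∫ u in x..y, Real.exp (-D * u) = (Real.exp (-D * x) - Real.exp (-D * y)) / D := by
  rw [intervalIntegral.integral_comp_mul_left (fun u => Real.exp u) (neg_ne_zero.2 hD),
    integral_exp, smul_eq_mul]
  field_simp
  ring

/-- Renewal asymptotics in multiplicative form: a monotone counting function equal to `1` below
`x₁` whose scaling defect `L` eventually vanishes has exact power growth in the nonlattice case. -/
theorem tendsto_div_rpow_of_scaling {N : ℕ} (hN : 2 ≤ N) {r : Fin N → ℝ}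
    (hr : ∀ j, r j ∈ Set.Ioo (0 : ℝ) 1) (hnl : ¬ IsLatticeVec r) {D : ℝ}
    (hD : ∑ j, r j ^ D = 1) {x₁ : ℝ} (hx₁ : 0 < x₁) {n L : ℝ → ℝ} (hn : ∀ x, 0 ≤ n x)
    (hmono : ∀ x y, 0 < x → x ≤ y → n x ≤ n y) (hone : ∀ x, 0 < x → x < x₁ → n x = 1)
    (hL : ∀ x, L x = n x - ∑ j, n (r j * x)) (hL0 : ∀ᶠ x in atTop, L x = 0) :
    Tendsto (fun x => n x / x ^ D) atTop
      (𝓝 ((((N : ℝ) - 1) * x₁ ^ (-D) / D + ∫ x in Set.Ioi x₁, L x * x ^ (-D - 1)) /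
        ∑ j, r j ^ D * Real.log (1 / r j))) := by
  have hD0 := pos_of_sum_rpow_eq_one hN hr hD
  have : Nonempty (Fin N) := ⟨⟨0, by omega⟩⟩
  set g : ℝ → ℝ := fun t => Real.exp (-D * t) * n (Real.exp t) with hg
  set a : Fin N → ℝ := fun j => -Real.log (r j) with ha
  set p : Fin N → ℝ := fun j => r j ^ D with hp
  set t₁ := Real.log x₁ with ht₁
  have hexp₁ : Real.exp t₁ = x₁ := Real.exp_log hx₁
  have ha0 : ∀ j, 0 < a j := fun j => neg_pos.2 (Real.log_neg (hr j).1 (hr j).2)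
  have hp0 : ∀ j, 0 < p j := fun j => Real.rpow_pos_of_pos (hr j).1 D
  have hpa : ∀ j, p j = Real.exp (-D * a j) := fun j => by
    simp only [hp, ha, Real.rpow_def_of_pos (hr j).1]
    congr 1
    ring
  have hdef : ∀ t, g t - ∑ j, p j * g (t - a j) = Real.exp (-D * t) * L (Real.exp t) := by
    intro t
    rw [hL, mul_sub, Finset.mul_sum]
    congr 1
    refine Finset.sum_congr rfl fun j _ => ?_
    have h1 : Real.exp (t - a j) = r j * Real.exp t := by
      simp only [ha, sub_neg_eq_add, Real.exp_add, Real.exp_log (hr j).1, mul_comm]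
    simp only [hg, h1, hpa j]
    rw [← mul_assoc, ← Real.exp_add]
    congr 2
    ring
  have hint : ∀ x y, IntervalIntegrable g volume x y := fun x y => by
    have h1 : Monotone fun t => n (Real.exp t) := fun s t hst =>
      hmono _ _ (Real.exp_pos s) (Real.exp_le_exp.2 hst)
    exact h1.intervalIntegrable.continuousOn_mul (by fun_prop)
  obtain ⟨T, hT₁, hT⟩ : ∃ T, t₁ ≤ T ∧ ∀ t, T ≤ t → L (Real.exp t) = 0 := by
    obtain ⟨T, hT⟩ := eventually_atTop.1 (Real.tendsto_exp_atTop.eventually hL0)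
    exact ⟨max T t₁, le_max_right _ _, fun t ht => hT t ((le_max_left _ _).trans ht)⟩
  have hstart : ∑ j, p j * (∫ u in (t₁ - a j)..t₁, g u) = ((N : ℝ) - 1) * x₁ ^ (-D) / D := by
    have h1 : ∀ j, p j * (∫ u in (t₁ - a j)..t₁, g u) = (1 - p j) * (x₁ ^ (-D) / D) := by
      intro j
      have h2 : ∫ u in (t₁ - a j)..t₁, g u = ∫ u in (t₁ - a j)..t₁, Real.exp (-D * u) := by
        refine intervalIntegral.integral_congr_Ioo_of_le (by linarith [ha0 j]) fun u hu => ?_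
        have h3 : n (Real.exp u) = 1 :=
          hone _ (Real.exp_pos u) (hexp₁ ▸ Real.exp_lt_exp.2 hu.2)
        simp [hg, h3]
      have h4 : x₁ ^ (-D) = Real.exp (-D * t₁) := by
        rw [Real.rpow_def_of_pos hx₁, mul_comm]
      have h5 : Real.exp (-D * (t₁ - a j)) * p j = Real.exp (-D * t₁) := by
        rw [hpa j, ← Real.exp_add]
        congr 1
        ring
      rw [h2, integral_exp_mul hD0.ne', h4, ← h5]
      ring
    rw [Finset.sum_congr rfl fun j _ => h1 j, ← Finset.sum_mul, Finset.sum_sub_distrib, hD]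
    simp
    ring
  have hchange : ∫ x in Set.Ioi x₁, L x * x ^ (-D - 1) =
      ∫ t in Set.Ioi t₁, Real.exp (-D * t) * L (Real.exp t) := by
    rw [← hexp₁, ← Real.image_exp_Ioi, integral_image_eq_integral_abs_deriv_smul
      measurableSet_Ioi (fun x _ => (Real.hasDerivAt_exp x).hasDerivWithinAt)
      Real.exp_injective.injOn]
    refine integral_congr_ae (Eventually.of_forall fun t => ?_)
    simp only [smul_eq_mul, abs_of_pos (Real.exp_pos t)]
    rw [← Real.exp_mul, mul_left_comm, ← Real.exp_add, mul_comm]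
    congr 2
    ring
  have hI : ∀ t, T ≤ t → ∑ j, p j * (∫ u in (t - a j)..t, g u) =
      ((N : ℝ) - 1) * x₁ ^ (-D) / D + ∫ x in Set.Ioi x₁, L x * x ^ (-D - 1) := by
    intro t ht
    rw [← hstart, ← sub_eq_iff_eq_add', sum_integral_sub_sum_integral (p := p) hD hint, hchange,
      intervalIntegral.integral_of_le (hT₁.trans ht)]
    simp only [hdef]
    refine (setIntegral_eq_of_subset_of_forall_sdiff_eq_zero measurableSet_Ioi
      Set.Ioc_subset_Ioi_self fun u hu => ?_).symm
    have h1 : t < u := by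
      by_contra! h2
      exact hu.2 ⟨hu.1, h2⟩
    rw [hT u (ht.trans h1.le), mul_zero]
  have hren := tendsto_of_averaging (g := g) (D := D) hp0 hD ha0
    (dense_closure_range_log_of_not_isLatticeVec (by omega) hr hnl) hD0
    (fun t => mul_nonneg (Real.exp_pos _).le (hn _))
    (fun t v hv => by
      simp only [hg]
      rw [← mul_assoc, ← Real.exp_add, ← mul_add, add_comm v t]
      exact mul_le_mul_of_nonneg_left
        (hmono _ _ (Real.exp_pos t) (Real.exp_le_exp.2 (by linarith))) (Real.exp_pos _).le)
    hint (fun t ht => by rw [← sub_eq_zero, hdef, hT t ht, mul_zero]) hI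
  have hden : ∑ j, p j * a j = ∑ j, r j ^ D * Real.log (1 / r j) := by
    simp [hp, ha]
  rw [hden] at hren
  refine (hren.comp Real.tendsto_log_atTop).congr' ?_
  filter_upwards [eventually_gt_atTop 0] with x hx
  simp only [Function.comp, hg, Real.exp_log hx]
  rw [Real.rpow_def_of_pos hx, div_eq_mul_inv, ← Real.exp_neg, mul_comm]
  congr 2
  ring

/-- For a nonlattice, strongly separated self-similar system with attractor `F`, similarity
dimension `D`, and numerator `h(s) = (N-1) x₁^{-s} + s ∫_{x₁}^∞ L(x) x^{-s-1} dx` nonvanishing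
on `S_r`, the attractor is box-counting measurable: `N_B(F,x)/x^D` converges to a positive
limit, equal to `h(D) / (D ∑_j r_j^D log(1/r_j))`. -/
theorem stmt19 {m N : ℕ} (hN : 2 ≤ N)
    (φ : Fin N → EuclideanSpace ℝ (Fin m) → EuclideanSpace ℝ (Fin m))
    (r : Fin N → ℝ) (hr : ∀ j, r j ∈ Set.Ioo (0 : ℝ) 1)
    (hsim : ∀ j, IsSimilarity (φ j) (r j))
    (F : Set (EuclideanSpace ℝ (Fin m)))
    (hFne : F.Nonempty) (hFc : IsCompact F) (hFinv : F = ⋃ j, φ j '' F)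
    (hsep : Pairwise fun i j => Disjoint (φ i '' F) (φ j '' F))
    (hnl : ¬ IsLatticeVec r)
    (D : ℝ) (hD : ∑ j, r j ^ D = 1)
    (x₁ : ℝ) (hx₁ : x₁ = sSup {x : ℝ | 0 < x ∧ boxCount F x = 1})
    (L : ℝ → ℝ) (hL : ∀ x, L x = (boxCount F x : ℝ) - ∑ j, (boxCount F (r j * x) : ℝ))
    (h : ℂ → ℂ)
    (hh : ∀ s : ℂ, h s = ((N : ℂ) - 1) * (x₁ : ℂ) ^ (-s) +
      s * (∫ x in Set.Ioi x₁, (L x : ℂ) * (x : ℂ) ^ (-s - 1)))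
    (hne : ∀ ω ∈ MoranSet r, h ω ≠ 0) :
    ∃ c : ℝ, 0 < c ∧
      Tendsto (fun x : ℝ => (boxCount F x : ℝ) / x ^ D) atTop (𝓝 c) ∧
      (c : ℂ) = h (D : ℂ) /
        ((D : ℂ) * ∑ j, (((r j : ℂ)) ^ (D : ℂ) * (Real.log (1 / r j) : ℂ))) := by
  have hr0 : ∀ j, 0 < r j := fun j => (hr j).1
  have hD0 := pos_of_sum_rpow_eq_one hN hr hD
  have hpos := sSup_boxCount_eq_one_pos hFc (nontrivial_of_separated hN hFne hFinv hsep)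
  rw [← hx₁] at hpos
  have hL0 : ∀ᶠ x in atTop, L x = 0 := by
    filter_upwards [eventually_sum_le_boxCount hr0 hsim hFc hFinv hsep, eventually_gt_atTop 0]
      with x hx hx0
    rw [hL, sub_eq_zero]
    exact_mod_cast le_antisymm (boxCount_le_sum hr0 hsim hFc hFinv hx0) hx
  have hlim := tendsto_div_rpow_of_scaling hN hr hnl hD hpos.1 (n := fun x => (boxCount F x : ℝ))
    (fun x => Nat.cast_nonneg _) (fun x y hx hxy => by exact_mod_cast boxCount_mono hFc hx hxy)
    (fun x hx hlt => by exact_mod_cast hpos.2 x hx hlt) hL hL0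
  set μ := ∑ j, r j ^ D * Real.log (1 / r j) with hμ
  set J := ∫ x in Set.Ioi x₁, L x * x ^ (-D - 1) with hJ
  set c := (((N : ℝ) - 1) * x₁ ^ (-D) / D + J) / μ with hc
  have hμ0 : 0 < μ := by
    have : Nonempty (Fin N) := ⟨⟨0, by omega⟩⟩
    refine Finset.sum_pos (fun j _ => mul_pos (Real.rpow_pos_of_pos (hr0 j) D) ?_)
      Finset.univ_nonempty
    exact Real.log_pos (one_lt_one_div (hr0 j) (hr j).2)
  have hμC : ∑ j, (((r j : ℂ)) ^ (D : ℂ) * (Real.log (1 / r j) : ℂ)) = (μ : ℂ) := by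
    rw [hμ, Complex.ofReal_sum]
    refine Finset.sum_congr rfl fun j _ => ?_
    rw [Complex.ofReal_mul, Complex.ofReal_cpow (hr0 j).le]
  have hJC : ∫ x in Set.Ioi x₁, (L x : ℂ) * (x : ℂ) ^ (-(D : ℂ) - 1) = (J : ℂ) := by
    rw [hJ, ← integral_complex_ofReal]
    refine setIntegral_congr_fun measurableSet_Ioi fun x hx => ?_
    have hx0 : 0 ≤ x := (hpos.1.trans hx).le
    simp [Complex.ofReal_cpow hx0]
  have hhD : h D = ((((N : ℝ) - 1) * x₁ ^ (-D) + D * J : ℝ) : ℂ) := by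
    rw [hh, hJC]
    simp [Complex.ofReal_cpow hpos.1.le]
  have hcD : (c : ℂ) = h (D : ℂ) / ((D : ℂ) * (μ : ℂ)) := by
    rw [hhD, hc, ← Complex.ofReal_mul, ← Complex.ofReal_div]
    congr 1
    field_simp
  have hMoran : (D : ℂ) ∈ MoranSet r := by
    show ∑ j, ((r j : ℂ)) ^ (D : ℂ) = 1
    rw [← Complex.ofReal_one, ← hD, Complex.ofReal_sum]
    exact Finset.sum_congr rfl fun j _ => (Complex.ofReal_cpow (hr0 j).le D).symm
  refine ⟨c, lt_of_le_of_ne ?_ ?_, hlim, by rw [hμC, hcD]⟩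
  · refine ge_of_tendsto hlim ?_
    filter_upwards [eventually_ge_atTop 0] with x hx
    exact div_nonneg (Nat.cast_nonneg _) (Real.rpow_nonneg hx D)
  · intro h0
    rw [← h0, Complex.ofReal_zero, eq_comm, div_eq_zero_iff] at hcD
    rcases hcD with h1 | h1
    · exact hne _ hMoran h1
    · exact absurd h1 (by exact_mod_cast (mul_pos hD0 hμ0).ne')
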